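/- Let H be an elementary abelian 2-hypergroup and F, G closed subsets of H. Then F ≃ G (there is an isomorphism from F to G) if and only if s(F) = s(G) and r_2(F) = r_2(G). -/

import Mathlib

namespace HyperPaper

/-- A hypergroup: hypermultiplication `hmul`, inversion `star`, identity `e`,
satisfying (H1) associativity, (H2) unique two-sided identity, (H3) exchange conditions. -/
structure Hypergroup (H : Type*) where
  hmul : H → H → Set H
  star : H → H
  e : H
  idl : ∀ p, hmul e p = {p}
  idr : ∀ p, hmul p e = {p}
  e_unique : ∀ e' : H, (∀ p, hmul e' p = {p} ∧ hmul p e' = {p}) → e' = e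
  assoc : ∀ p q r : H, (⋃ x ∈ hmul p q, hmul x r) = ⋃ x ∈ hmul q r, hmul p x
  h3l : ∀ p q r : H, p ∈ hmul q r ↔ q ∈ hmul p (star r)
  h3r : ∀ p q r : H, p ∈ hmul q r ↔ r ∈ hmul (star q) p

variable {H : Type*}

namespace Hypergroup

/-- Product of two subsets: FG = {a : ∃ b ∈ F, c ∈ G, a ∈ bc}. -/
def smul (hg : Hypergroup H) (F G : Set H) : Set H :=
  {a | ∃ b ∈ F, ∃ c ∈ G, a ∈ hg.hmul b c}

/-- Closed subset: nonempty and G*G ⊆ G. -/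
def IsClosed (hg : Hypergroup H) (G : Set H) : Prop :=
  G.Nonempty ∧ hg.smul (hg.star '' G) G ⊆ G

/-- Thin element: p*p = {e}. -/
def IsThin (hg : Hypergroup H) (p : H) : Prop := hg.hmul (hg.star p) p = {hg.e}

/-- Thick element: not thin. -/
def IsThick (hg : Hypergroup H) (p : H) : Prop := ¬ hg.IsThin p

/-- Involution: p ≠ e and {e, p} is closed. -/
def IsInvolution (hg : Hypergroup H) (p : H) : Prop :=
  p ≠ hg.e ∧ hg.IsClosed {hg.e, p}

/-- ⟨G⟩: smallest closed subset containing G. -/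
def gen (hg : Hypergroup H) (G : Set H) : Set H := ⋂₀ {C | hg.IsClosed C ∧ G ⊆ C}

/-- O_ϑ(G): the thin elements of H lying in G. -/
def Othin (hg : Hypergroup H) (G : Set H) : Set H := {p ∈ G | hg.IsThin p}

/-- F is a strongly normal closed subset of G: p*Fp ⊆ F ⊆ G for all p ∈ G. -/
def IsStronglyNormal (hg : Hypergroup H) (F G : Set H) : Prop :=
  hg.IsClosed F ∧ hg.IsClosed G ∧ F ⊆ G ∧
    ∀ p ∈ G, hg.smul (hg.smul {hg.star p} F) {p} ⊆ F

/-- O^ϑ(G): intersection of all strongly normal closed subsets of ⟨G⟩. -/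
def Osup (hg : Hypergroup H) (G : Set H) : Set H :=
  ⋂₀ {F | hg.IsStronglyNormal F (hg.gen G)}

/-- F is a normal closed subset of G. -/
def IsNormal (hg : Hypergroup H) (F G : Set H) : Prop :=
  hg.IsClosed F ∧ hg.IsClosed G ∧ F ⊆ G ∧ ∀ p ∈ G, hg.smul F {p} = hg.smul {p} F

/-- Product of a list of subsets (empty product is {e}). -/
def listProd (hg : Hypergroup H) : List (Set H) → Set H
  | [] => {hg.e}
  | a :: l => hg.smul a (hg.listProd l)

/-- Product r_1 r_2 ⋯ r_n of a family of elements. -/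
def famProd (hg : Hypergroup H) {n : ℕ} (r : Fin n → H) : Set H :=
  hg.listProd ((List.finRange n).map fun i => ({r i} : Set H))

/-- Ĝ_i: the product of the G_j with j ≠ i. -/
def cofactor (hg : Hypergroup H) {n : ℕ} (G : Fin n → Set H) (i : Fin n) : Set H :=
  hg.listProd (((List.finRange n).filter fun j => decide (j ≠ i)).map G)

/-- H is the direct product of the normal closed subsets G_1, …, G_n. -/
def IsDirectProduct (hg : Hypergroup H) {n : ℕ} (G : Fin n → Set H) : Prop :=
  (∀ i, hg.IsNormal (G i) Set.univ) ∧
  (∀ i, hg.smul (G i) (hg.cofactor G i) = Set.univ) ∧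
  (∀ i, G i ∩ hg.cofactor G i = {hg.e})

/-- r : Fin n → H is a decomposition of x with respect to the family G. -/
def IsDecomp (hg : Hypergroup H) {n : ℕ} (G : Fin n → Set H) (x : H) (r : Fin n → H) : Prop :=
  (∀ i, r i ∈ G i) ∧ x ∈ hg.famProd r

/-- The support of x: the elements ≠ e appearing in the decomposition of x. -/
def dsupport (hg : Hypergroup H) {n : ℕ} (G : Fin n → Set H) (x : H) : Set H :=
  {y | y ≠ hg.e ∧ ∃ r, hg.IsDecomp G x r ∧ y ∈ Set.range r}

/-- The cover of x: the product r_1r_2⋯r_n for the decomposition of x. -/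
def dcover (hg : Hypergroup H) {n : ℕ} (G : Fin n → Set H) (x : H) : Set H :=
  {y | ∃ r, hg.IsDecomp G x r ∧ y ∈ hg.famProd r}

/-- x is constrained: its cover equals {x}. -/
def IsConstrained (hg : Hypergroup H) {n : ℕ} (G : Fin n → Set H) (x : H) : Prop :=
  hg.dcover G x = {x}

/-- r_2(G): the largest 2-rank of a thin closed subset of H contained in G
(equivalently, the largest k such that G contains a thin symmetric closed subset
of 2^k elements, which corresponds to an elementary abelian 2-group of 2-rank k). -/
noncomputable def rank2 (hg : Hypergroup H) (G : Set H) : ℕ :=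
  sSup {k | ∃ U : Set H, hg.IsClosed U ∧ U ⊆ G ∧ (∀ u ∈ U, hg.IsThin u) ∧
    (∀ u ∈ U, hg.star u = u) ∧ U.ncard = 2 ^ k}

/-- F is a minimal generating subset of G. -/
def IsMinGen (hg : Hypergroup H) (G F : Set H) : Prop :=
  F ⊆ G ∧ hg.gen F = G ∧ ∀ p ∈ F, hg.gen (F \ {p}) ≠ G

/-- The dimension of G: the smallest cardinality of a minimal generating subset. -/
noncomputable def dimension (hg : Hypergroup H) (G : Set H) : ℕ :=
  sInf {k | ∃ F : Set H, hg.IsMinGen G F ∧ F.Finite ∧ F.ncard = k}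

/-- [F, G] = ⟨{a : ∃ b ∈ F, c ∈ G, a ∈ b*c*bc}⟩. -/
def commSet (hg : Hypergroup H) (F G : Set H) : Set H :=
  hg.gen {a | ∃ b ∈ F, ∃ c ∈ G,
    a ∈ hg.smul (hg.smul (hg.smul {hg.star b} {hg.star c}) {b}) {c}}

/-- derived G k = G^{(k+1)}: G^{(1)} = G, G^{(r)} = [G^{(r-1)}, G]. -/
def derived (hg : Hypergroup H) (G : Set H) : ℕ → Set H
  | 0 => G
  | k + 1 => hg.commSet (hg.derived G k) G

/-- G is nilpotent: G^{(r)} = {e} for some r. -/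
def IsNilpotent (hg : Hypergroup H) (G : Set H) : Prop :=
  ∃ k : ℕ, hg.derived G k = {hg.e}

/-- G is a residually thin closed subset: there is a chain {e} = F_1, …, F_n = G of
pairwise distinct closed subsets, each strongly normal in the next. -/
def IsResiduallyThin (hg : Hypergroup H) (G : Set H) : Prop :=
  ∃ (m : ℕ) (F : Fin (m + 1) → Set H), Function.Injective F ∧
    F 0 = {hg.e} ∧ F (Fin.last m) = G ∧
    ∀ i : Fin m, hg.IsStronglyNormal (F i.castSucc) (F i.succ)

/-- x^k as a subset: x^0 = {e}, x^{k+1} = x^k · x. -/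
def spow (hg : Hypergroup H) (x : H) : ℕ → Set H
  | 0 => {hg.e}
  | k + 1 => hg.smul (hg.spow x k) {x}

/-- F is a maximal closed subset of G. -/
def IsMaximalClosed (hg : Hypergroup H) (F G : Set H) : Prop :=
  hg.IsClosed F ∧ hg.IsClosed G ∧ F ⊆ G ∧ F ≠ G ∧
    ∀ E : Set H, hg.IsClosed E → F ⊆ E → E ⊆ G → E = F ∨ E = G

/-- The Frattini closed subset of G: the intersection (inside G) of all maximal
closed subsets of G. -/
def frattini (hg : Hypergroup H) (G : Set H) : Set H :=
  G ∩ ⋂₀ {F | hg.IsMaximalClosed F G}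

/-- α is an isomorphism from the closed subset F to the closed subset G. -/
def IsIso (hg : Hypergroup H) (F G : Set H) (α : H → H) : Prop :=
  Set.BijOn α F G ∧ α hg.e = hg.e ∧
    ∀ p ∈ F, ∀ q ∈ F, α '' hg.hmul p q = hg.hmul (α p) (α q)

/-- F ≃ G: there is an isomorphism from F to G. -/
def Isomorphic (hg : Hypergroup H) (F G : Set H) : Prop := ∃ α : H → H, hg.IsIso F G α

/-- Aut(G): the automorphism group of G, realized as the subgroup of permutations of G
that fix e and preserve the hypermultiplication. -/
def autGroup (hg : Hypergroup H) (G : Set H) : Subgroup (Equiv.Perm G) where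
  carrier := {σ | (∀ x : G, (x : H) = hg.e → ((σ x : H)) = hg.e) ∧
    ∀ p q x : G, (x : H) ∈ hg.hmul p q ↔ ((σ x : H)) ∈ hg.hmul (σ p) (σ q)}
  one_mem' := by
    constructor
    · intro x hx; simpa using hx
    · intro p q x; simp
  mul_mem' := by
    rintro σ τ ⟨he1, hm1⟩ ⟨he2, hm2⟩
    refine ⟨fun x hx => ?_, fun p q x => ?_⟩
    · simpa using he1 _ (he2 x hx)
    · simpa using (hm2 p q x).trans (hm1 (τ p) (τ q) (τ x))
  inv_mem' := by
    rintro σ ⟨he, hm⟩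
    refine ⟨fun x hx => ?_, fun p q x => ?_⟩
    · have h2 : σ x = x := Subtype.ext ((he x hx).trans hx.symm)
      have h3 : σ⁻¹ x = x := by
        conv_lhs => rw [← h2]
        simp
      rw [h3]; exact hx
    · have h := hm (σ⁻¹ p) (σ⁻¹ q) (σ⁻¹ x)
      simpa using h.symm

end Hypergroup

/-- An elementary abelian 2-hypergroup: a hypergroup that is the constrained direct
product of the closed subsets ⟨q_1⟩, …, ⟨q_n⟩ generated by involutions q_1, …, q_n. -/
structure EA2Data (H : Type*) where
  hg : Hypergroup H
  n : ℕ
  q : Fin n → H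
  invol : ∀ i, hg.IsInvolution (q i)
  dp : hg.IsDirectProduct fun i => hg.gen {q i}
  constrained : ∀ x : H, hg.IsConstrained (fun i => hg.gen {q i}) x

namespace EA2Data

/-- The family ⟨q_1⟩, …, ⟨q_n⟩. -/
def fam (E : EA2Data H) : Fin E.n → Set H := fun i => E.hg.gen {E.q i}

/-- The support of x. -/
def support (E : EA2Data H) (x : H) : Set H := E.hg.dsupport E.fam x

/-- Thick(F): externally thick elements of H lying in F. -/
def ThickIn (E : EA2Data H) (F : Set H) : Set H :=
  {x ∈ F | x = E.hg.e ∨ ∀ y ∈ E.support x, E.hg.IsThick y}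

/-- Thin(F): externally thin elements of H lying in F. -/
def ThinIn (E : EA2Data H) (F : Set H) : Set H :=
  {x ∈ F | x = E.hg.e ∨ ∀ y ∈ E.support x, E.hg.IsThin y}

/-- The (unique) pair (x⁺, x⁻) with x⁺ ∈ Thick(H), x⁻ ∈ Thin(H), x⁺x⁻ = {x}. -/
noncomputable def pm (E : EA2Data H) (x : H) : H × H :=
  @Classical.epsilon (H × H) ⟨(E.hg.e, E.hg.e)⟩ fun z =>
    z.1 ∈ E.ThickIn Set.univ ∧ z.2 ∈ E.ThinIn Set.univ ∧ E.hg.hmul z.1 z.2 = {x}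

/-- x⁺. -/
noncomputable def plus (E : EA2Data H) (x : H) : H := (E.pm x).1

/-- x⁻. -/
noncomputable def minus (E : EA2Data H) (x : H) : H := (E.pm x).2

/-- s(x): the number of thick elements of H in the support of x. -/
noncomputable def sElem (E : EA2Data H) (x : H) : ℕ :=
  {y ∈ E.support x | E.hg.IsThick y}.ncard

/-- s(G) = max {s(a) : a ∈ G}. -/
noncomputable def sSet (E : EA2Data H) (G : Set H) : ℕ :=
  sSup {k | ∃ a ∈ G, E.sElem a = k}

/-- x ⪯ y: the support of x is contained in the support of y. -/
def ple (E : EA2Data H) (x y : H) : Prop := E.support x ⊆ E.support y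

/-- p♯: the number of thick elements among q_1, …, q_n. -/
noncomputable def psharp (E : EA2Data H) : ℕ := {i : Fin E.n | E.hg.IsThick (E.q i)}.ncard

end EA2Data

/-- The Gaussian binomial coefficient C(n, k)_2 with base 2, via the
q-Pascal recurrence C(n, k)_2 = C(n-1, k-1)_2 + 2^k · C(n-1, k)_2. -/
def gaussBinom2 : ℕ → ℕ → ℕ
  | _, 0 => 1
  | 0, _ + 1 => 0
  | n + 1, k + 1 => gaussBinom2 n k + 2 ^ (k + 1) * gaussBinom2 n (k + 1)

end HyperPaper

namespace HyperPaper

variable {H : Type*}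

namespace Hypergroup

variable (hg : Hypergroup H)

/-- The subsets of `H`, with the multiplication induced by the hypermultiplication. -/
def Subsets (_ : Hypergroup H) : Type _ := Set H

instance : Monoid hg.Subsets where
  mul F G := hg.smul F G
  one := ({hg.e} : Set H)
  mul_assoc F G K := by
    have key (p q r a : H) :
        (∃ x ∈ hg.hmul p q, a ∈ hg.hmul x r) ↔ ∃ x ∈ hg.hmul q r, a ∈ hg.hmul p x := by
      simpa using Set.ext_iff.1 (hg.assoc p q r) a
    change hg.smul (hg.smul F G) K = hg.smul F (hg.smul G K)
    ext a
    constructor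
    · rintro ⟨x, ⟨p, hp, q, hq, hx⟩, r, hr, ha⟩
      obtain ⟨y, hy, hy'⟩ := (key p q r a).1 ⟨x, hx, ha⟩
      exact ⟨p, hp, y, ⟨q, hq, r, hr, hy⟩, hy'⟩
    · rintro ⟨p, hp, y, ⟨q, hq, r, hr, hy⟩, ha⟩
      obtain ⟨x, hx, hx'⟩ := (key p q r a).2 ⟨y, hy, ha⟩
      exact ⟨x, ⟨p, hp, q, hq, hx⟩, r, hr, hx'⟩
  one_mul F := by
    change hg.smul {hg.e} F = F
    ext a
    simp [smul, hg.idl]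
  mul_one F := by
    change hg.smul F {hg.e} = F
    ext a
    simp [smul, hg.idr]

/-- The singleton `{x}` as an element of the monoid of subsets. -/
def single (x : H) : hg.Subsets := ({x} : Set H)

instance : Membership H hg.Subsets := ⟨fun F x => Set.Mem F x⟩

variable {hg}

theorem mem_mul {F G : hg.Subsets} {a : H} :
    a ∈ F * G ↔ ∃ b ∈ F, ∃ c ∈ G, a ∈ hg.hmul b c := Iff.rfl

theorem mem_single {x a : H} : a ∈ hg.single x ↔ a = x := Iff.rfl

theorem mem_one {a : H} : a ∈ (1 : hg.Subsets) ↔ a = hg.e := Iff.rfl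

theorem subsets_ext {F G : hg.Subsets} (h : ∀ a, a ∈ F ↔ a ∈ G) : F = G := Set.ext h

theorem single_e : hg.single hg.e = 1 := rfl

theorem mem_single_mul_single {p q a : H} :
    a ∈ hg.single p * hg.single q ↔ a ∈ hg.hmul p q := by
  simp [mem_mul, mem_single]

variable (hg)

theorem single_mul_single (p q : H) : hg.single p * hg.single q = hg.hmul p q :=
  subsets_ext fun _ => mem_single_mul_single

theorem listProd_eq_prod (l : List (Set H)) :
    hg.listProd l = (show List hg.Subsets from l).prod := by
  induction l with
  | nil => rfl
  | cons a l ih =>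
    change hg.smul a (hg.listProd l) = hg.smul a _
    rw [ih]
    rfl

theorem famProd_eq_prod {n : ℕ} (r : Fin n → H) :
    hg.famProd r = ((List.finRange n).map fun i => hg.single (r i)).prod :=
  hg.listProd_eq_prod _

theorem e_mem_star_hmul (p : H) : hg.e ∈ hg.hmul (hg.star p) p :=
  (hg.h3r p p hg.e).1 (by simp [hg.idr])

theorem star_eq_of_e_mem {p : H} (h : hg.e ∈ hg.hmul p p) : hg.star p = p := by
  have := (hg.h3r _ _ _).1 h
  rw [hg.idr] at this
  exact this.symm

theorem hmul_nonempty (p q : H) : (hg.hmul p q).Nonempty := by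
  have h : q ∈ hg.single (hg.star p) * hg.single p * hg.single q :=
    ⟨hg.e, mem_single_mul_single.2 (hg.e_mem_star_hmul p), q, rfl, by simp [hg.idl]⟩
  rw [mul_assoc, hg.single_mul_single p q] at h
  obtain ⟨_, _, x, hx, _⟩ := h
  exact ⟨x, hx⟩

theorem prod_single_nonempty {ι : Type*} (l : List ι) (r : ι → H) :
    ∃ x, x ∈ (l.map fun i => hg.single (r i)).prod := by
  induction l with
  | nil => exact ⟨hg.e, rfl⟩
  | cons a l ih =>
    obtain ⟨y, hy⟩ := ih
    obtain ⟨x, hx⟩ := hg.hmul_nonempty (r a) y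
    exact ⟨x, by rw [List.map_cons, List.prod_cons]; exact ⟨r a, rfl, y, hy, hx⟩⟩

theorem e_mem_listProd {l : List (Set H)} (hl : ∀ F ∈ l, hg.e ∈ F) : hg.e ∈ hg.listProd l := by
  induction l with
  | nil => rfl
  | cons G l ih =>
    exact ⟨hg.e, hl _ (by simp), hg.e, ih fun F hF => hl F (by simp [hF]), by simp [hg.idl]⟩

theorem mem_listProd {l : List (Set H)} (hl : ∀ F ∈ l, hg.e ∈ F) {F : Set H} (hF : F ∈ l) {x : H}
    (hx : x ∈ F) : x ∈ hg.listProd l := by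
  induction l with
  | nil => simp at hF
  | cons G l ih =>
    have hl' : ∀ F ∈ l, hg.e ∈ F := fun F hF => hl F (by simp [hF])
    rcases List.mem_cons.1 hF with rfl | hF
    · exact ⟨x, hx, hg.e, hg.e_mem_listProd hl', by simp [hg.idr]⟩
    · exact ⟨hg.e, hl _ (by simp), x, ih hl' hF, by simp [hg.idl]⟩

variable {hg}

theorem IsClosed.e_mem {F : Set H} (hF : hg.IsClosed F) : hg.e ∈ F := by
  obtain ⟨x, hx⟩ := hF.1
  exact hF.2 ⟨hg.star x, ⟨x, hx, rfl⟩, x, hx, hg.e_mem_star_hmul x⟩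

theorem IsInvolution.star_eq {q : H} (h : hg.IsInvolution q) : hg.star q = q := by
  have h1 : hg.star q ∈ ({hg.e, q} : Set H) :=
    h.2.2 ⟨hg.star q, ⟨q, by simp, rfl⟩, hg.e, by simp, by simp [hg.idr]⟩
  rcases h1 with h1 | h1
  · have := hg.e_mem_star_hmul q
    rw [h1, hg.idl] at this
    exact absurd this.symm h.1
  · exact h1

theorem IsInvolution.e_mem_hmul {q : H} (h : hg.IsInvolution q) : hg.e ∈ hg.hmul q q := by
  simpa [h.star_eq] using hg.e_mem_star_hmul q

theorem IsInvolution.hmul_subset {q : H} (h : hg.IsInvolution q) :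
    hg.hmul q q ⊆ {hg.e, q} := fun x hx =>
  h.2.2 ⟨hg.star q, ⟨q, by simp, rfl⟩, q, by simp, by rwa [h.star_eq]⟩

theorem IsInvolution.mem_hmul_iff {q : H} (h : hg.IsInvolution q) :
    q ∈ hg.hmul q q ↔ hg.IsThick q := by
  rw [IsThick, IsThin, h.star_eq]
  constructor
  · intro h1 h2
    rw [h2] at h1
    exact h.1 h1
  · intro h1
    by_contra h2
    refine h1 (Set.Subset.antisymm (fun x hx => ?_) (by simpa using h.e_mem_hmul))
    rcases h.hmul_subset hx with rfl | rfl
    · rfl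
    · exact absurd hx h2

theorem IsInvolution.gen_eq {q : H} (h : hg.IsInvolution q) : hg.gen {q} = {hg.e, q} := by
  refine Set.Subset.antisymm (Set.sInter_subset_of_mem ⟨h.2, by simp⟩) ?_
  rintro x hx C ⟨hC, hqC⟩
  rcases hx with rfl | rfl
  · exact hC.e_mem
  · exact hqC rfl

end Hypergroup

namespace EA2Data

open Hypergroup

variable (E : EA2Data H)

/-- The element of `{e, q i}` selected by a bit. -/
def pick (i : Fin E.n) (a : ZMod 2) : H := if a = 1 then E.q i else E.hg.e

theorem zmod_two_cases (a : ZMod 2) : a = 0 ∨ a = 1 := by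
  revert a; decide

theorem pick_zero (i : Fin E.n) : E.pick i 0 = E.hg.e := if_neg (by decide)

theorem pick_one (i : Fin E.n) : E.pick i 1 = E.q i := if_pos rfl

theorem mem_gen_iff {i : Fin E.n} {x : H} : x ∈ E.hg.gen {E.q i} ↔ ∃ a, x = E.pick i a := by
  rw [(E.invol i).gen_eq]
  constructor
  · rintro (rfl | rfl)
    · exact ⟨0, (E.pick_zero i).symm⟩
    · exact ⟨1, (E.pick_one i).symm⟩
  · rintro ⟨a, rfl⟩
    rcases zmod_two_cases a with rfl | rfl
    · simp [pick_zero]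
    · simp [pick_one]

theorem e_mem_gen (i : Fin E.n) : E.hg.e ∈ E.hg.gen {E.q i} :=
  E.mem_gen_iff.2 ⟨0, (E.pick_zero i).symm⟩

theorem pick_mem_hmul_iff (i : Fin E.n) (a b c : ZMod 2) :
    E.pick i c ∈ E.hg.hmul (E.pick i a) (E.pick i b) ↔
      (E.hg.IsThick (E.q i) ∧ a = 1 ∧ b = 1) ∨ c = a + b := by
  have h := E.invol i
  have h1 := h.1
  have h2 : (1 : ZMod 2) + 1 = 0 := by decide
  rcases zmod_two_cases a with rfl | rfl <;> rcases zmod_two_cases b with rfl | rfl <;>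
    rcases zmod_two_cases c with rfl | rfl <;>
    simp [pick_zero, pick_one, E.hg.idl, E.hg.idr, h1, Ne.symm h1, h.mem_hmul_iff,
      h.e_mem_hmul, h2]

theorem e_mem_cofactor (i : Fin E.n) :
    E.hg.e ∈ E.hg.cofactor (fun i => E.hg.gen {E.q i}) i := by
  refine E.hg.e_mem_listProd fun F hF => ?_
  obtain ⟨k, -, rfl⟩ := List.mem_map.1 hF
  exact E.e_mem_gen k

theorem mem_cofactor {i j : Fin E.n} (hij : j ≠ i) {x : H} (hx : x ∈ E.hg.gen {E.q j}) :
    x ∈ E.hg.cofactor (fun i => E.hg.gen {E.q i}) i := by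
  refine E.hg.mem_listProd (F := E.hg.gen {E.q j}) ?_ ?_ hx
  · intro F hF
    obtain ⟨k, -, rfl⟩ := List.mem_map.1 hF
    exact E.e_mem_gen k
  · exact List.mem_map.2 ⟨j, by simpa using hij, rfl⟩

theorem q_not_mem_cofactor (i : Fin E.n) :
    E.q i ∉ E.hg.cofactor (fun i => E.hg.gen {E.q i}) i := by
  intro h
  have := (E.dp.2.2 i).subset ⟨E.mem_gen_iff.2 ⟨1, (E.pick_one i).symm⟩, h⟩
  exact (E.invol i).1 this

theorem q_injective : Function.Injective E.q := by
  intro i j hij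
  by_contra hne
  refine E.q_not_mem_cofactor i (E.mem_cofactor (Ne.symm hne) ?_)
  rw [hij]
  exact E.mem_gen_iff.2 ⟨1, (E.pick_one j).symm⟩

theorem hmul_q_subset (i j : Fin E.n) :
    E.hg.hmul (E.q i) (E.q j) ⊆ E.hg.hmul (E.q j) (E.q i) := by
  by_cases hij : i = j
  · subst hij
    exact subset_rfl
  intro x hx
  have h : x ∈ E.hg.smul (E.hg.gen {E.q i}) {E.q j} :=
    ⟨E.q i, E.mem_gen_iff.2 ⟨1, (E.pick_one i).symm⟩, E.q j, rfl, hx⟩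
  rw [(E.dp.1 i).2.2.2 (E.q j) trivial] at h
  obtain ⟨_, rfl, p, hp, hxp⟩ := h
  obtain ⟨a, rfl⟩ := E.mem_gen_iff.1 hp
  rcases zmod_two_cases a with rfl | rfl
  · rw [pick_zero, E.hg.idr] at hxp
    obtain rfl : x = E.q j := hxp
    refine absurd (E.mem_cofactor (j := j) (i := i) (Ne.symm hij) ?_) (E.q_not_mem_cofactor i)
    have := (E.hg.h3l _ _ _).1 hx
    rw [(E.invol j).star_eq] at this
    rw [(E.invol j).gen_eq]
    exact (E.invol j).hmul_subset this
  · rwa [pick_one] at hxp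

theorem commute_q (i j : Fin E.n) : Commute (E.hg.single (E.q i)) (E.hg.single (E.q j)) := by
  rw [Commute, SemiconjBy, single_mul_single, single_mul_single]
  exact Set.Subset.antisymm (E.hmul_q_subset i j) (E.hmul_q_subset j i)

theorem commute_pick (i j : Fin E.n) (a b : ZMod 2) :
    Commute (E.hg.single (E.pick i a)) (E.hg.single (E.pick j b)) := by
  rcases zmod_two_cases a with rfl | rfl <;> rcases zmod_two_cases b with rfl | rfl <;>
    simp [pick_zero, pick_one, single_e, E.commute_q i j]

theorem exists_decomp (x : H) : ∃ v : Fin E.n → ZMod 2,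
    ((List.finRange E.n).map fun i => E.hg.single (E.pick i (v i))).prod = E.hg.single x := by
  have h := E.constrained x
  obtain ⟨r, ⟨hr, hx⟩, -⟩ := h.ge rfl
  choose v hv using fun i => E.mem_gen_iff.1 (hr i)
  obtain rfl : r = fun i => E.pick i (v i) := funext hv
  refine ⟨v, ?_⟩
  rw [← famProd_eq_prod]
  exact Set.Subset.antisymm (fun y hy => h.le ⟨_, ⟨hr, hx⟩, hy⟩) (Set.singleton_subset_iff.2 hx)

theorem commute_single (x y : H) : Commute (E.hg.single x) (E.hg.single y) := by
  obtain ⟨v, hv⟩ := E.exists_decomp x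
  obtain ⟨w, hw⟩ := E.exists_decomp y
  rw [← hv, ← hw]
  refine Commute.list_prod_left _ _ fun a ha => Commute.list_prod_right _ _ fun b hb => ?_
  obtain ⟨i, -, rfl⟩ := List.mem_map.1 ha
  obtain ⟨j, -, rfl⟩ := List.mem_map.1 hb
  exact E.commute_pick _ _ _ _

theorem hmul_comm (x y : H) : E.hg.hmul x y = E.hg.hmul y x := by
  rw [← single_mul_single, ← single_mul_single]
  exact E.commute_single x y

instance : CommMonoid E.hg.Subsets where
  mul_comm _ _ := subsets_ext fun _ =>
    ⟨fun ⟨b, hb, c, hc, h⟩ => ⟨c, hc, b, hb, E.hmul_comm b c ▸ h⟩,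
      fun ⟨b, hb, c, hc, h⟩ => ⟨c, hc, b, hb, E.hmul_comm b c ▸ h⟩⟩

theorem famProd_eq_finset_prod (r : Fin E.n → H) :
    E.hg.famProd r = ∏ i, E.hg.single (r i) := by
  rw [Fin.prod_univ_def]
  exact E.hg.famProd_eq_prod r

theorem mem_prod_iff {ι : Type*} [DecidableEq ι] (s : Finset ι) (F : ι → E.hg.Subsets) (x : H) :
    x ∈ ∏ i ∈ s, F i ↔ ∃ r : ι → H, (∀ i ∈ s, r i ∈ F i) ∧ x ∈ ∏ i ∈ s, E.hg.single (r i) := by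
  induction s using Finset.induction_on generalizing x with
  | empty =>
    rw [Finset.prod_empty]
    exact ⟨fun h => ⟨fun _ => E.hg.e, by simp, h⟩, fun ⟨_, _, h⟩ => h⟩
  | insert a s ha ih =>
    simp only [Finset.prod_insert ha, mem_mul]
    constructor
    · rintro ⟨b, hb, c, hc, hx⟩
      obtain ⟨r, hr, hcr⟩ := (ih c).1 hc
      refine ⟨Function.update r a b, ?_, b, ?_, c, ?_, hx⟩
      · intro i hi
        by_cases hia : i = a
        · subst hia
          simpa using hb
        · simpa [hia] using hr i (Finset.mem_of_mem_insert_of_ne hi hia)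
      · simp [mem_single]
      · convert hcr using 1
        refine Finset.prod_congr rfl fun i hi => ?_
        rw [Function.update_of_ne (ne_of_mem_of_not_mem hi ha)]
    · rintro ⟨r, hr, b, hb, c, hc, hx⟩
      obtain rfl := mem_single.1 hb
      exact ⟨r a, hr a (by simp), c, (ih c).2 ⟨r, fun i hi => hr i (by simp [hi]), hc⟩, hx⟩

theorem exists_eq_prod_pick (v : Fin E.n → ZMod 2) :
    ∃ x, ∏ i, E.hg.single (E.pick i (v i)) = E.hg.single x := by
  obtain ⟨x, hx⟩ := E.hg.prod_single_nonempty (List.finRange E.n) fun i => E.pick i (v i)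
  have hx' : x ∈ E.hg.famProd fun i => E.pick i (v i) := by
    rw [famProd_eq_prod]
    exact hx
  refine ⟨x, ?_⟩
  rw [← famProd_eq_finset_prod]
  refine Set.Subset.antisymm (fun y hy => (E.constrained x).le ⟨_, ⟨?_, hx'⟩, hy⟩)
    (Set.singleton_subset_iff.2 hx')
  exact fun i => E.mem_gen_iff.2 ⟨_, rfl⟩

/-- The element of `H` with prescribed coordinates. -/
noncomputable def el (v : Fin E.n → ZMod 2) : H := (E.exists_eq_prod_pick v).choose

theorem prod_pick (v : Fin E.n → ZMod 2) :
    ∏ i, E.hg.single (E.pick i (v i)) = E.hg.single (E.el v) :=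
  (E.exists_eq_prod_pick v).choose_spec

theorem el_zero : E.el 0 = E.hg.e := by
  have h := E.prod_pick 0
  simp only [Pi.zero_apply, pick_zero, single_e, Finset.prod_const_one] at h
  exact (mem_single.1 (h ▸ mem_one.2 rfl)).symm

theorem el_surjective : Function.Surjective E.el := by
  intro x
  obtain ⟨v, hv⟩ := E.exists_decomp x
  refine ⟨v, ?_⟩
  change E.el v ∈ E.hg.single x
  rw [← hv, ← Fin.prod_univ_def, prod_pick]
  rfl

theorem single_mul_single_el (v w : Fin E.n → ZMod 2) :
    E.hg.single (E.el v) * E.hg.single (E.el w) =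
      ∏ i, E.hg.single (E.pick i (v i)) * E.hg.single (E.pick i (w i)) := by
  rw [← prod_pick, ← prod_pick, Finset.prod_mul_distrib]

theorem mem_hmul_el_of_forall {u v w : Fin E.n → ZMod 2}
    (h : ∀ i, E.pick i (u i) ∈ E.hg.hmul (E.pick i (v i)) (E.pick i (w i))) :
    E.el u ∈ E.hg.hmul (E.el v) (E.el w) := by
  rw [← mem_single_mul_single, single_mul_single_el, mem_prod_iff]
  refine ⟨fun i => E.pick i (u i), fun i _ => mem_single_mul_single.2 (h i), ?_⟩
  rw [prod_pick]
  rfl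

theorem star_eq (x : H) : E.hg.star x = x := by
  obtain ⟨v, rfl⟩ := E.el_surjective x
  apply star_eq_of_e_mem
  rw [← el_zero]
  refine E.mem_hmul_el_of_forall fun i => (E.pick_mem_hmul_iff i _ _ _).2 (Or.inr ?_)
  rw [CharTwo.add_self_eq_zero, Pi.zero_apply]

theorem cofactor_mul_mem {i : Fin E.n} {x y z : H}
    (hx : x ∈ E.hg.cofactor (fun i => E.hg.gen {E.q i}) i)
    (hy : y ∈ E.hg.cofactor (fun i => E.hg.gen {E.q i}) i)
    (hz : z ∈ E.hg.hmul x y) : z ∈ E.hg.cofactor (fun i => E.hg.gen {E.q i}) i := by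
  let P : Fin E.n → E.hg.Subsets := fun i => E.hg.gen {E.q i}
  have hP (j) : P j * P j = P j := by
    apply subsets_ext
    intro a
    constructor
    · rintro ⟨b, hb, c, hc, ha⟩
      exact (E.dp.1 j).1.2 ⟨b, ⟨b, hb, E.star_eq b⟩, c, hc, ha⟩
    · intro ha
      exact ⟨a, ha, E.hg.e, E.e_mem_gen j, by simp [E.hg.idr]⟩
  have hc : E.hg.cofactor (fun i => E.hg.gen {E.q i}) i =
      (((List.finRange E.n).filter fun j => decide (j ≠ i)).map P).prod :=
    E.hg.listProd_eq_prod _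
  have hC : (((List.finRange E.n).filter fun j => decide (j ≠ i)).map P).prod *
      (((List.finRange E.n).filter fun j => decide (j ≠ i)).map P).prod =
      (((List.finRange E.n).filter fun j => decide (j ≠ i)).map P).prod := by
    rw [← List.prod_map_mul]
    simp only [hP]
  rw [hc] at hx hy ⊢
  rw [← hC]
  exact ⟨x, hx, y, hy, hz⟩

theorem prod_subset_cofactor {i : Fin E.n} {r : Fin E.n → H} (hr : ∀ j, r j ∈ E.hg.gen {E.q j})
    (s : Finset (Fin E.n)) (hs : ∀ j ∈ s, j ≠ i) {x : H} (hx : x ∈ ∏ j ∈ s, E.hg.single (r j)) :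
    x ∈ E.hg.cofactor (fun i => E.hg.gen {E.q i}) i := by
  induction s using Finset.induction_on generalizing x with
  | empty =>
    rw [Finset.prod_empty, mem_one] at hx
    subst hx
    exact E.e_mem_cofactor i
  | insert a s ha ih =>
    rw [Finset.prod_insert ha] at hx
    obtain ⟨_, rfl, c, hc, hx⟩ := hx
    exact E.cofactor_mul_mem (E.mem_cofactor (hs a (by simp)) (hr a))
      (ih (fun j hj => hs j (by simp [hj])) hc) hx

theorem el_injective : Function.Injective E.el := by
  have key : ∀ v w : Fin E.n → ZMod 2, E.el v = E.el w → ∀ i, v i = 1 → w i = 0 → False := by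
    intro v w h i hv hw
    have hgen (u : Fin E.n → ZMod 2) (j) : E.pick j (u j) ∈ E.hg.gen {E.q j} :=
      E.mem_gen_iff.2 ⟨_, rfl⟩
    have h1 : E.el v ∈ ∏ j, E.hg.single (E.pick j (v j)) := by rw [prod_pick]; rfl
    rw [← Finset.mul_prod_erase _ _ (Finset.mem_univ i), hv, pick_one] at h1
    obtain ⟨_, rfl, c, hc, h1⟩ := h1
    have h2 : E.el w ∈ ∏ j, E.hg.single (E.pick j (w j)) := by rw [prod_pick]; rfl
    rw [← Finset.mul_prod_erase _ _ (Finset.mem_univ i), hw, pick_zero, single_e, one_mul] at h2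
    rw [h, E.hg.h3l, E.star_eq] at h1
    exact E.q_not_mem_cofactor i (E.cofactor_mul_mem
      (E.prod_subset_cofactor (hgen w) _ (by simp) h2)
      (E.prod_subset_cofactor (hgen v) _ (by simp) hc) h1)
  intro v w h
  funext i
  rcases zmod_two_cases (v i) with hv | hv <;> rcases zmod_two_cases (w i) with hw | hw
  · rw [hv, hw]
  · exact (key w v h.symm i hw hv).elim
  · exact (key v w h i hv hw).elim
  · rw [hv, hw]

/-- The coordinates of an element of `H`. -/
noncomputable def coord : H ≃ (Fin E.n → ZMod 2) :=
  (Equiv.ofBijective E.el ⟨E.el_injective, E.el_surjective⟩).symm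

theorem coord_el (v : Fin E.n → ZMod 2) : E.coord (E.el v) = v :=
  (Equiv.ofBijective E.el ⟨E.el_injective, E.el_surjective⟩).symm_apply_apply v

theorem coord_e : E.coord E.hg.e = 0 := by rw [← el_zero, coord_el]

theorem mem_hmul_iff (x y z : H) : x ∈ E.hg.hmul y z ↔
    ∀ i, (E.hg.IsThick (E.q i) ∧ E.coord y i = 1 ∧ E.coord z i = 1) ∨
      E.coord x i = E.coord y i + E.coord z i := by
  obtain ⟨u, rfl⟩ := E.el_surjective x
  obtain ⟨v, rfl⟩ := E.el_surjective y
  obtain ⟨w, rfl⟩ := E.el_surjective z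
  simp only [coord_el, ← pick_mem_hmul_iff]
  refine ⟨fun h => ?_, E.mem_hmul_el_of_forall⟩
  rw [← mem_single_mul_single, single_mul_single_el, mem_prod_iff] at h
  obtain ⟨r, hr, hu⟩ := h
  have hr' (i) : r i ∈ E.hg.hmul (E.pick i (v i)) (E.pick i (w i)) :=
    mem_single_mul_single.1 (hr i (Finset.mem_univ i))
  have hg (i) : ∃ a, r i = E.pick i a := by
    refine E.mem_gen_iff.1 ((E.dp.1 i).1.2 ⟨_, ⟨_, ?_, E.star_eq _⟩, _, ?_, hr' i⟩)
    · exact E.mem_gen_iff.2 ⟨_, rfl⟩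
    · exact E.mem_gen_iff.2 ⟨_, rfl⟩
  choose t ht using hg
  simp only [ht] at hu hr'
  rw [prod_pick, mem_single] at hu
  rw [E.el_injective hu]
  exact hr'

theorem support_eq (x : H) : E.support x = E.q '' {i | E.coord x i = 1} := by
  obtain ⟨v, rfl⟩ := E.el_surjective x
  rw [coord_el]
  ext y
  constructor
  · rintro ⟨hy, r, ⟨hr, hx⟩, i, rfl⟩
    choose w hw using fun i => E.mem_gen_iff.1 (hr i)
    obtain rfl : r = fun i => E.pick i (w i) := funext hw
    rw [famProd_eq_finset_prod, prod_pick] at hx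
    obtain rfl := E.el_injective hx
    rcases zmod_two_cases (v i) with h | h
    · simp [h, pick_zero] at hy
    · exact ⟨i, h, by simp [h, pick_one]⟩
  · rintro ⟨i, hi, rfl⟩
    refine ⟨(E.invol i).1, fun i => E.pick i (v i), ⟨fun i => E.mem_gen_iff.2 ⟨_, rfl⟩, ?_⟩, i, ?_⟩
    · rw [famProd_eq_finset_prod, prod_pick]
      rfl
    · rw [Set.mem_ofPred_eq] at hi
      simp [hi, pick_one]

theorem sElem_eq (x : H) :
    E.sElem x = {i | E.hg.IsThick (E.q i) ∧ E.coord x i = 1}.ncard := by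
  rw [sElem, support_eq, ← Set.ncard_image_of_injective _ E.q_injective]
  congr 1
  ext y
  constructor
  · rintro ⟨⟨i, hi, rfl⟩, hy⟩
    exact ⟨i, ⟨hy, hi⟩, rfl⟩
  · rintro ⟨i, ⟨hy, hi⟩, rfl⟩
    exact ⟨⟨i, hi, rfl⟩, hy⟩

theorem isClosed_iff {F : Set H} : E.hg.IsClosed F ↔
    F.Nonempty ∧ ∀ x ∈ F, ∀ y ∈ F, E.hg.hmul x y ⊆ F := by
  have h : E.hg.star '' F = F := by simp [E.star_eq]
  unfold Hypergroup.IsClosed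
  rw [h]
  refine and_congr_right fun _ => ⟨fun h x hx y hy z hz => h ⟨x, hx, y, hy, hz⟩, ?_⟩
  rintro h z ⟨x, hx, y, hy, hz⟩
  exact h x hx y hy hz

theorem isThin_iff_hmul (x : H) : E.hg.IsThin x ↔ E.hg.hmul x x = {E.hg.e} := by
  rw [IsThin, E.star_eq]

theorem isThin_iff (x : H) :
    E.hg.IsThin x ↔ ∀ i, E.hg.IsThick (E.q i) → E.coord x i = 0 := by
  rw [isThin_iff_hmul]
  constructor
  · intro h i hi
    by_contra h0
    have h1 : x ∈ E.hg.hmul x x → x = E.hg.e := fun hx => h.subset hx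
    have hs : E.coord.symm (Pi.single i 1) ∈ E.hg.hmul x x := by
      rw [mem_hmul_iff]
      intro j
      by_cases hj : j = i
      · subst hj
        have := (zmod_two_cases (E.coord x j)).resolve_left h0
        exact Or.inl ⟨hi, this, this⟩
      · right
        simp [hj, CharTwo.add_self_eq_zero]
    rw [h] at hs
    have := congrFun (congrArg E.coord hs) i
    rw [coord_e] at this
    simp at this
  · intro h
    ext y
    rw [mem_hmul_iff, Set.mem_singleton_iff, ← E.coord.injective.eq_iff, coord_e, funext_iff]
    refine forall_congr' fun i => ?_
    rw [CharTwo.add_self_eq_zero, Pi.zero_apply, or_iff_right]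
    rintro ⟨h1, h2, -⟩
    simp [h i h1] at h2

/-- The thick coordinates occurring in elements of `F`. -/
def thickSupport (F : Set H) : Set (Fin E.n) :=
  {i | E.hg.IsThick (E.q i) ∧ ∃ x ∈ F, E.coord x i = 1}

open Classical in
/-- The vector obtained by erasing the thick coordinates. -/
noncomputable def thinPart (v : Fin E.n → ZMod 2) : Fin E.n → ZMod 2 :=
  fun i => if E.hg.IsThick (E.q i) then 0 else v i

variable {E}

/-- The coordinate vectors of the thin elements of a closed subset. -/
def thinSpace {F : Set H} (hF : E.hg.IsClosed F) : Submodule (ZMod 2) (Fin E.n → ZMod 2) where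
  carrier := {v | E.coord.symm v ∈ F ∧ ∀ i, E.hg.IsThick (E.q i) → v i = 0}
  zero_mem' := ⟨by rw [← coord_e, Equiv.symm_apply_apply]; exact hF.e_mem, by simp⟩
  add_mem' := by
    rintro v w ⟨hv, hv'⟩ ⟨hw, hw'⟩
    refine ⟨(E.isClosed_iff.1 hF).2 _ hv _ hw ?_, fun i hi => by simp [hv' i hi, hw' i hi]⟩
    rw [mem_hmul_iff]
    exact fun i => Or.inr (by simp)
  smul_mem' := by
    rintro a v hv
    rcases zmod_two_cases a with rfl | rfl
    · rw [zero_smul]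
      exact ⟨by rw [← coord_e, Equiv.symm_apply_apply]; exact hF.e_mem, by simp⟩
    · rwa [one_smul]

theorem mem_thinSpace {F : Set H} (hF : E.hg.IsClosed F) {v : Fin E.n → ZMod 2} :
    v ∈ thinSpace hF ↔ E.coord.symm v ∈ F ∧ ∀ i, E.hg.IsThick (E.q i) → v i = 0 := Iff.rfl

theorem thinPart_mem {F : Set H} (hF : E.hg.IsClosed F) {x : H} (hx : x ∈ F) :
    E.thinPart (E.coord x) ∈ thinSpace hF := by
  have hc := (E.isClosed_iff.1 hF).2
  refine ⟨?_, fun i hi => if_pos hi⟩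
  have h1 : E.coord.symm (E.coord x + E.thinPart (E.coord x)) ∈ F := by
    refine hc x hx x hx ((E.mem_hmul_iff _ _ _).2 fun i => ?_)
    by_cases hi : E.hg.IsThick (E.q i)
    · rcases zmod_two_cases (E.coord x i) with h | h
      · exact Or.inr (by simp [thinPart, hi, h])
      · exact Or.inl ⟨hi, h, h⟩
    · exact Or.inr (by simp [thinPart, hi])
  refine hc x hx _ h1 ((E.mem_hmul_iff _ _ _).2 fun i => Or.inr ?_)
  simp [← add_assoc, CharTwo.add_self_eq_zero]

theorem single_mem {F : Set H} (hF : E.hg.IsClosed F) {i : Fin E.n} (hi : i ∈ E.thickSupport F) :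
    E.coord.symm (Pi.single i 1) ∈ F := by
  obtain ⟨ht, x, hx, h1⟩ := hi
  refine (E.isClosed_iff.1 hF).2 x hx x hx ((E.mem_hmul_iff _ _ _).2 fun j => ?_)
  by_cases hj : j = i
  · subst hj
    exact Or.inl ⟨ht, h1, h1⟩
  · exact Or.inr (by simp [hj, CharTwo.add_self_eq_zero])

theorem mem_iff {F : Set H} (hF : E.hg.IsClosed F) {x : H} : x ∈ F ↔
    (∀ i, E.hg.IsThick (E.q i) → E.coord x i = 1 → i ∈ E.thickSupport F) ∧
      E.thinPart (E.coord x) ∈ thinSpace hF := by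
  classical
  refine ⟨fun hx => ⟨fun i hi h => ⟨hi, x, hx, h⟩, thinPart_mem hF hx⟩, ?_⟩
  rintro ⟨h1, h2⟩
  have key : ∀ A : Finset (Fin E.n), (∀ i ∈ A, i ∈ E.thickSupport F) →
      E.coord.symm (E.thinPart (E.coord x) + ∑ i ∈ A, Pi.single i 1) ∈ F := by
    intro A
    induction A using Finset.induction_on with
    | empty =>
      intro _
      simpa using h2.1
    | insert a A ha ih =>
      intro hA
      refine (E.isClosed_iff.1 hF).2 _ (ih fun i hi => hA i (by simp [hi])) _
        (single_mem hF (hA a (by simp))) ((E.mem_hmul_iff _ _ _).2 fun i => Or.inr ?_)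
      simp only [Equiv.apply_symm_apply, Finset.sum_insert ha, Pi.add_apply]
      ring
  have := key {i | E.hg.IsThick (E.q i) ∧ E.coord x i = 1} fun i hi => by
    simp only [Finset.mem_filter, Finset.mem_univ, true_and] at hi
    exact h1 i hi.1 hi.2
  convert this
  rw [Equiv.eq_symm_apply]
  funext i
  rw [Pi.add_apply, Finset.sum_apply]
  by_cases hi : E.hg.IsThick (E.q i) <;> rcases zmod_two_cases (E.coord x i) with h | h <;>
    simp [thinPart, Pi.single_apply, hi, h]

open Classical in
/-- A closed subset decomposes into its thick coordinates and its thin part. -/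
noncomputable def closedEquiv {F : Set H} (hF : E.hg.IsClosed F) :
    F ≃ (E.thickSupport F → ZMod 2) × thinSpace hF where
  toFun x := (fun i => E.coord x i, ⟨E.thinPart (E.coord x), thinPart_mem hF x.2⟩)
  invFun p := ⟨E.coord.symm fun i => if h : i ∈ E.thickSupport F then p.1 ⟨i, h⟩ else p.2.1 i, by
    rw [mem_iff hF, Equiv.apply_symm_apply]
    constructor
    · intro i hi h
      by_contra hS
      rw [dif_neg hS, p.2.2.2 i hi] at h
      exact absurd h (by decide)
    · convert p.2.2 using 1
      funext i
      by_cases hi : E.hg.IsThick (E.q i)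
      · simp [thinPart, hi, p.2.2.2 i hi]
      · have : i ∉ E.thickSupport F := fun h => hi h.1
        simp [thinPart, hi, this]⟩
  left_inv x := by
    apply Subtype.ext
    rw [Equiv.symm_apply_eq]
    funext i
    by_cases hS : i ∈ E.thickSupport F
    · simp [hS]
    · by_cases hi : E.hg.IsThick (E.q i)
      · have : E.coord x i ≠ 1 := fun h => hS ⟨hi, x, x.2, h⟩
        simp [hS, thinPart, hi, (zmod_two_cases _).resolve_right this]
      · simp [hS, thinPart, hi]
  right_inv p := by
    refine Prod.ext ?_ (Subtype.ext ?_)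
    · funext i
      simp
    · funext i
      by_cases hi : E.hg.IsThick (E.q i)
      · simp [thinPart, hi, p.2.2.2 i hi]
      · have : i ∉ E.thickSupport F := fun h => hi h.1
        simp [thinPart, hi, this]

theorem closedEquiv_fst {F : Set H} (hF : E.hg.IsClosed F) (x : F) (i : E.thickSupport F) :
    (closedEquiv hF x).1 i = E.coord x i := rfl

theorem closedEquiv_snd {F : Set H} (hF : E.hg.IsClosed F) (x : F) :
    ((closedEquiv hF x).2 : Fin E.n → ZMod 2) = E.thinPart (E.coord x) := rfl

theorem closedEquiv_e {F : Set H} (hF : E.hg.IsClosed F) :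
    closedEquiv hF ⟨E.hg.e, hF.e_mem⟩ = 0 := by
  refine Prod.ext ?_ (Subtype.ext ?_)
  · funext i
    simp [closedEquiv_fst, coord_e]
  · funext i
    simp [closedEquiv_snd, coord_e, thinPart]

theorem mem_hmul_iff_closedEquiv {F : Set H} (hF : E.hg.IsClosed F) (x y z : F) :
    (x : H) ∈ E.hg.hmul y z ↔
      (∀ i, ((closedEquiv hF y).1 i = 1 ∧ (closedEquiv hF z).1 i = 1) ∨
        (closedEquiv hF x).1 i = (closedEquiv hF y).1 i + (closedEquiv hF z).1 i) ∧
      (closedEquiv hF x).2 = (closedEquiv hF y).2 + (closedEquiv hF z).2 := by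
  simp only [mem_hmul_iff, closedEquiv_fst, Subtype.ext_iff, Submodule.coe_add, closedEquiv_snd,
    funext_iff, Pi.add_apply]
  constructor
  · refine fun h => ⟨fun i => (h i).imp_left And.right, fun i => ?_⟩
    by_cases hi : E.hg.IsThick (E.q i)
    · simp [thinPart, hi]
    · simpa [thinPart, hi] using h i
  · rintro ⟨h1, h2⟩ i
    by_cases hi : E.hg.IsThick (E.q i)
    · by_cases hS : i ∈ E.thickSupport F
      · exact (h1 ⟨i, hS⟩).imp_left fun h => ⟨hi, h⟩
      · have h0 (x : F) : E.coord x i = 0 :=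
          (zmod_two_cases _).resolve_right fun h => hS ⟨hi, x, x.2, h⟩
        exact Or.inr (by simp [h0])
    · simpa [thinPart, hi] using h2 i

theorem isThin_iff_closedEquiv {F : Set H} (hF : E.hg.IsClosed F) (x : F) :
    E.hg.IsThin x ↔ (closedEquiv hF x).1 = 0 := by
  rw [isThin_iff, funext_iff]
  constructor
  · exact fun h i => h i i.2.1
  · intro h i hi
    by_contra h0
    exact h0 (h ⟨i, hi, x, x.2, (zmod_two_cases _).resolve_left h0⟩)

theorem ncard_closed {F : Set H} (hF : E.hg.IsClosed F) :
    F.ncard = 2 ^ (E.thickSupport F).ncard * 2 ^ Module.finrank (ZMod 2) (thinSpace hF) := by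
  rw [← Nat.card_coe_set_eq, Nat.card_congr (closedEquiv hF), Nat.card_prod, Nat.card_fun,
    Module.natCard_eq_pow_finrank (K := ZMod 2) (V := thinSpace hF), Nat.card_zmod,
    Nat.card_coe_set_eq]

/-- The thin elements of a closed subset correspond to its thin space. -/
noncomputable def othinEquiv {F : Set H} (hF : E.hg.IsClosed F) :
    E.hg.Othin F ≃ thinSpace hF where
  toFun x := (closedEquiv hF ⟨x, x.2.1⟩).2
  invFun v := ⟨(closedEquiv hF).symm (0, v), Subtype.prop _, by simp [isThin_iff_closedEquiv hF]⟩
  left_inv x := by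
    apply Subtype.ext
    have h := (isThin_iff_closedEquiv hF ⟨x, x.2.1⟩).1 x.2.2
    change (((closedEquiv hF).symm (0, _) : F) : H) = _
    rw [← h]
    simp
  right_inv v := by simp

theorem ncard_othin {F : Set H} (hF : E.hg.IsClosed F) :
    (E.hg.Othin F).ncard = 2 ^ Module.finrank (ZMod 2) (thinSpace hF) := by
  rw [← Nat.card_coe_set_eq, Nat.card_congr (othinEquiv hF),
    Module.natCard_eq_pow_finrank (K := ZMod 2) (V := thinSpace hF), Nat.card_zmod]

theorem isClosed_othin {F : Set H} (hF : E.hg.IsClosed F) : E.hg.IsClosed (E.hg.Othin F) := by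
  rw [isClosed_iff]
  refine ⟨⟨E.hg.e, hF.e_mem, ?_⟩, ?_⟩
  · rw [isThin_iff, coord_e]
    simp
  · rintro x ⟨hx, hx'⟩ y ⟨hy, hy'⟩ z hz
    refine ⟨(E.isClosed_iff.1 hF).2 x hx y hy hz, ?_⟩
    rw [isThin_iff] at *
    intro i hi
    rcases (E.mem_hmul_iff _ _ _).1 hz i with ⟨-, h, -⟩ | h
    · simp [hx' i hi] at h
    · simp [h, hx' i hi, hy' i hi]

theorem rank2_eq {F : Set H} (hF : E.hg.IsClosed F) :
    E.hg.rank2 F = Module.finrank (ZMod 2) (thinSpace hF) := by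
  have : Finite H := Finite.of_equiv _ E.coord.symm
  refine IsGreatest.csSup_eq ⟨⟨E.hg.Othin F, isClosed_othin hF, fun x hx => hx.1,
    fun x hx => hx.2, fun x _ => E.star_eq x, ncard_othin hF⟩, ?_⟩
  rintro k ⟨U, -, hUF, hU, -, hk⟩
  have : U.ncard ≤ (E.hg.Othin F).ncard :=
    Set.ncard_le_ncard fun x hx => ⟨hUF hx, hU x hx⟩
  rw [hk, ncard_othin hF] at this
  exact (Nat.pow_le_pow_iff_right (by norm_num)).1 this

theorem sSet_eq {F : Set H} (hF : E.hg.IsClosed F) : E.sSet F = (E.thickSupport F).ncard := by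
  refine IsGreatest.csSup_eq ⟨?_, ?_⟩
  · let x : F := (closedEquiv hF).symm (fun _ => 1, 0)
    have hx : (closedEquiv hF x).1 = fun _ => 1 := by simp [x]
    refine ⟨x, x.2, ?_⟩
    rw [sElem_eq]
    congr 1
    ext i
    exact ⟨fun h => ⟨h.1, x, x.2, h.2⟩, fun h => ⟨h.1, congrFun hx ⟨i, h⟩⟩⟩
  · rintro k ⟨a, ha, rfl⟩
    rw [sElem_eq]
    exact Set.ncard_le_ncard fun i hi => ⟨hi.1, a, ha, hi.2⟩

theorem isomorphic_of_equiv {F G : Set H} (hF : E.hg.IsClosed F) (hG : E.hg.IsClosed G)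
    (σ : E.thickSupport G ≃ E.thickSupport F) (L : thinSpace hF ≃ₗ[ZMod 2] thinSpace hG) :
    E.hg.Isomorphic F G := by
  classical
  let Ψ : F ≃ G := (closedEquiv hF).trans
    (((Equiv.arrowCongr σ.symm (Equiv.refl _)).prodCongr L.toEquiv).trans (closedEquiv hG).symm)
  have h1 (x : F) (i) : (closedEquiv hG (Ψ x)).1 i = (closedEquiv hF x).1 (σ i) := by
    simp [Ψ, Equiv.arrowCongr]
  have h2 (x : F) : (closedEquiv hG (Ψ x)).2 = L (closedEquiv hF x).2 := by
    simp [Ψ]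
  have hΨ (x y z : F) : (Ψ x : H) ∈ E.hg.hmul (Ψ y) (Ψ z) ↔ (x : H) ∈ E.hg.hmul y z := by
    rw [mem_hmul_iff_closedEquiv hF, mem_hmul_iff_closedEquiv hG]
    simp only [h1, h2, ← map_add, L.injective.eq_iff]
    rw [σ.forall_congr_left]
    simp
  have he : Ψ ⟨E.hg.e, hF.e_mem⟩ = ⟨E.hg.e, hG.e_mem⟩ := by
    apply (closedEquiv hG).injective
    rw [closedEquiv_e]
    refine Prod.ext (funext fun i => ?_) ?_
    · rw [h1, closedEquiv_e]
      rfl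
    · rw [h2, closedEquiv_e]
      exact map_zero L
  let α : H → H := fun x => if h : x ∈ F then Ψ ⟨x, h⟩ else x
  have hα (x : F) : α x = Ψ x := by simp [α]
  refine ⟨α, ⟨fun x hx => ?_, fun x hx y hy h => ?_, fun y hy => ?_⟩, ?_, fun p hp q hq => ?_⟩
  · rw [hα ⟨x, hx⟩]
    exact Subtype.prop _
  · rw [hα ⟨x, hx⟩, hα ⟨y, hy⟩] at h
    exact congrArg Subtype.val (Ψ.injective (Subtype.ext h))
  · exact ⟨Ψ.symm ⟨y, hy⟩, Subtype.prop _, by rw [hα]; simp⟩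
  · rw [hα ⟨_, hF.e_mem⟩, he]
  · rw [hα ⟨p, hp⟩, hα ⟨q, hq⟩]
    ext y
    constructor
    · rintro ⟨x, hx, rfl⟩
      have hxF : x ∈ F := (E.isClosed_iff.1 hF).2 p hp q hq hx
      rw [hα ⟨x, hxF⟩]
      exact (hΨ _ _ _).2 hx
    · intro hy
      have hyG : y ∈ G := (E.isClosed_iff.1 hG).2 _ (Subtype.prop _) _ (Subtype.prop _) hy
      refine ⟨Ψ.symm ⟨y, hyG⟩, (hΨ _ ⟨p, hp⟩ ⟨q, hq⟩).1 (by simpa using hy), ?_⟩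
      rw [hα]
      simp

theorem ncard_othin_eq_of_isIso {F G : Set H} (hF : E.hg.IsClosed F) {α : H → H}
    (h : E.hg.IsIso F G α) : (E.hg.Othin F).ncard = (E.hg.Othin G).ncard := by
  obtain ⟨hb, he, hm⟩ := h
  have hthin {x : H} (hx : x ∈ F) : E.hg.IsThin (α x) ↔ E.hg.IsThin x := by
    rw [isThin_iff_hmul, isThin_iff_hmul, ← hm x hx x hx]
    constructor
    · intro h
      have hsub := (E.isClosed_iff.1 hF).2 x hx x hx
      rw [← he, ← Set.image_singleton] at h
      exact (hb.injOn.image_eq_image_iff hsub (by simpa using hF.e_mem)).1 h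
    · intro h
      rw [h, Set.image_singleton, he]
  have himg : α '' E.hg.Othin F = E.hg.Othin G := by
    ext y
    constructor
    · rintro ⟨x, hx, rfl⟩
      exact ⟨hb.mapsTo hx.1, (hthin hx.1).2 hx.2⟩
    · rintro ⟨hy, hy'⟩
      obtain ⟨x, hx, rfl⟩ := hb.surjOn hy
      exact ⟨x, ⟨hx, (hthin hx).1 hy'⟩, rfl⟩
  rw [← himg, (hb.injOn.mono fun x hx => hx.1).ncard_image]

end EA2Data

end HyperPaper

open HyperPaper

/-- Two closed subsets F, G of an elementary abelian 2-hypergroup are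
isomorphic iff s(F) = s(G) and r_2(F) = r_2(G). -/
theorem stmt15 {H : Type*} (E : EA2Data H) (F G : Set H)
    (hF : E.hg.IsClosed F) (hG : E.hg.IsClosed G) :
    E.hg.Isomorphic F G ↔ (E.sSet F = E.sSet G ∧ E.hg.rank2 F = E.hg.rank2 G) := by
  rw [EA2Data.sSet_eq hF, EA2Data.sSet_eq hG, EA2Data.rank2_eq hF, EA2Data.rank2_eq hG]
  constructor
  · rintro ⟨α, hα⟩
    have hthin := EA2Data.ncard_othin_eq_of_isIso hF hα
    rw [EA2Data.ncard_othin hF, EA2Data.ncard_othin hG] at hthin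
    have hcard : F.ncard = G.ncard := by
      rw [← hα.1.image_eq, hα.1.injOn.ncard_image]
    rw [EA2Data.ncard_closed hF, EA2Data.ncard_closed hG, hthin] at hcard
    exact ⟨Nat.pow_right_injective le_rfl (Nat.eq_of_mul_eq_mul_right (by positivity) hcard),
      Nat.pow_right_injective le_rfl hthin⟩
  · rintro ⟨hs, hr⟩
    rw [← Nat.card_coe_set_eq, ← Nat.card_coe_set_eq] at hs
    exact EA2Data.isomorphic_of_equiv hF hG ((Finite.card_eq.1 hs.symm).some)
      (LinearEquiv.ofFinrankEq _ _ hr)
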